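/- Let n ≥ 2 and let α be a real number with −1/(n²−1) ≤ α ≤ 1. Consider the isotropic state ρ = ((1−α)/n²)·I + α·|ψ⁺⟩⟨ψ⁺| on ℂ^n ⊗ ℂ^n, where |ψ⁺⟩ = (1/√n)·Σ_{i=1}^n e_i ⊗ e_i is the maximally entangled state. Then the following are equivalent: (1) ρ is absolutely separable; (2) ρ is absolutely PPT; (3) α ≤ 2/(2 + n²). -/

import Mathlib

open Matrix BigOperators
open scoped ComplexOrder

noncomputable section

/-- The partial transpose (on the second factor) of a matrix indexed by `Fin m × Fin n`. -/
def partialTranspose {m n : ℕ} (X : Matrix (Fin m × Fin n) (Fin m × Fin n) ℂ) :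
    Matrix (Fin m × Fin n) (Fin m × Fin n) ℂ :=
  Matrix.of fun p q => X (p.1, q.2) (q.1, p.2)

/-- A state is absolutely PPT if every unitary conjugate has positive semidefinite
partial transpose. -/
def AbsolutelyPPT {m n : ℕ} (ρ : Matrix (Fin m × Fin n) (Fin m × Fin n) ℂ) : Prop :=
  ∀ U : Matrix (Fin m × Fin n) (Fin m × Fin n) ℂ,
    U ∈ Matrix.unitaryGroup (Fin m × Fin n) ℂ →
      (partialTranspose (U * ρ * Uᴴ)).PosSemidef

/-- A matrix is separable if it is a finite sum of Kronecker products of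
positive semidefinite matrices. -/
def Separable {m n : ℕ} (σ : Matrix (Fin m × Fin n) (Fin m × Fin n) ℂ) : Prop :=
  ∃ (k : ℕ) (A : Fin k → Matrix (Fin m) (Fin m) ℂ) (B : Fin k → Matrix (Fin n) (Fin n) ℂ),
    (∀ i, (A i).PosSemidef) ∧ (∀ i, (B i).PosSemidef) ∧
      σ = ∑ i, Matrix.kroneckerMap (· * ·) (A i) (B i)

/-- A state is absolutely separable if every unitary conjugate of it is separable. -/
def AbsolutelySeparable {m n : ℕ} (ρ : Matrix (Fin m × Fin n) (Fin m × Fin n) ℂ) : Prop :=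
  ∀ U : Matrix (Fin m × Fin n) (Fin m × Fin n) ℂ,
    U ∈ Matrix.unitaryGroup (Fin m × Fin n) ℂ →
      Separable (U * ρ * Uᴴ)


/-- The maximally entangled state `|ψ⁺⟩ ∈ ℂⁿ ⊗ ℂⁿ`. -/
def psiPlus (n : ℕ) : Fin n × Fin n → ℂ :=
  fun p => if p.1 = p.2 then ((1 / Real.sqrt n : ℝ) : ℂ) else 0

namespace Separable

variable {m n : ℕ}

theorem sum_kronecker {ι : Type*} [Fintype ι] {A : ι → Matrix (Fin m) (Fin m) ℂ}
    {B : ι → Matrix (Fin n) (Fin n) ℂ} (hA : ∀ i, (A i).PosSemidef) (hB : ∀ i, (B i).PosSemidef) :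
    Separable (∑ i, Matrix.kroneckerMap (· * ·) (A i) (B i)) :=
  ⟨Fintype.card ι, fun i => A ((Fintype.equivFin ι).symm i),
    fun i => B ((Fintype.equivFin ι).symm i), fun _ => hA _, fun _ => hB _,
    ((Fintype.equivFin ι).symm.sum_comp
      fun i => Matrix.kroneckerMap (· * ·) (A i) (B i)).symm⟩

theorem sum {ι : Type*} [Fintype ι] {σ : ι → Matrix (Fin m × Fin n) (Fin m × Fin n) ℂ}
    (h : ∀ i, Separable (σ i)) : Separable (∑ i, σ i) := by
  choose k A B hA hB hσ using h
  have := sum_kronecker (A := fun p : (i : ι) × Fin (k i) => A p.1 p.2)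
    (B := fun p => B p.1 p.2) (fun p => hA _ _) (fun p => hB _ _)
  rw [Fintype.sum_sigma] at this
  simpa only [← hσ] using this

theorem add {σ τ : Matrix (Fin m × Fin n) (Fin m × Fin n) ℂ} (hσ : Separable σ)
    (hτ : Separable τ) : Separable (σ + τ) := by
  have := sum (σ := ![σ, τ]) (Fin.forall_fin_two.2 ⟨hσ, hτ⟩)
  simpa using this

theorem smul {σ : Matrix (Fin m × Fin n) (Fin m × Fin n) ℂ} (hσ : Separable σ) {c : ℝ}
    (hc : 0 ≤ c) : Separable ((c : ℂ) • σ) := by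
  obtain ⟨k, A, B, hA, hB, rfl⟩ := hσ
  refine ⟨k, fun i => (c : ℂ) • A i, B, fun i => (hA i).smul (by simpa using hc), hB, ?_⟩
  rw [Finset.smul_sum]
  exact Finset.sum_congr rfl fun i _ => (Matrix.smul_kronecker (c : ℂ) (A i) (B i)).symm

theorem kronecker {A : Matrix (Fin m) (Fin m) ℂ} {B : Matrix (Fin n) (Fin n) ℂ}
    (hA : A.PosSemidef) (hB : B.PosSemidef) : Separable (Matrix.kroneckerMap (· * ·) A B) :=
  ⟨1, fun _ => A, fun _ => B, fun _ => hA, fun _ => hB, by simp⟩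

theorem diagonal {d : Fin m × Fin n → ℝ} (hd : ∀ p, 0 ≤ d p) :
    Separable (Matrix.diagonal fun p => (d p : ℂ)) := by
  have := sum fun p : Fin m × Fin n => smul (kronecker
    (Matrix.PosSemidef.diagonal (d := Pi.single p.1 (1 : ℂ)) (by simp))
    (Matrix.PosSemidef.diagonal (d := Pi.single p.2 (1 : ℂ)) (by simp))) (hd p)
  convert this using 1
  ext ⟨i, k⟩ ⟨j, l⟩
  simp only [Matrix.sum_apply, Matrix.smul_apply, Matrix.kroneckerMap_apply,
    Matrix.diagonal_apply, Pi.single_apply, smul_eq_mul, Prod.mk.injEq]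
  rw [Finset.sum_eq_single (i, k)]
  · grind
  · grind
  · simp

theorem conj_kronecker {σ : Matrix (Fin m × Fin n) (Fin m × Fin n) ℂ} (hσ : Separable σ)
    (P : Matrix (Fin m) (Fin m) ℂ) (Q : Matrix (Fin n) (Fin n) ℂ) :
    Separable (Matrix.kroneckerMap (· * ·) P Q * σ * (Matrix.kroneckerMap (· * ·) P Q)ᴴ) := by
  obtain ⟨k, A, B, hA, hB, rfl⟩ := hσ
  refine ⟨k, fun i => P * A i * Pᴴ, fun i => Q * B i * Qᴴ,
    fun i => (hA i).mul_mul_conjTranspose_same P, fun i => (hB i).mul_mul_conjTranspose_same Q, ?_⟩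
  rw [Matrix.conjTranspose_kronecker, Finset.mul_sum, Finset.sum_mul]
  simp only [Matrix.mul_kronecker_mul]

theorem posSemidef_partialTranspose {σ : Matrix (Fin m × Fin n) (Fin m × Fin n) ℂ}
    (hσ : Separable σ) : (partialTranspose σ).PosSemidef := by
  obtain ⟨k, A, B, hA, hB, rfl⟩ := hσ
  have : partialTranspose (∑ i, Matrix.kroneckerMap (· * ·) (A i) (B i)) =
      ∑ i, Matrix.kroneckerMap (· * ·) (A i) (B i)ᵀ := by
    ext p q
    simp [partialTranspose, Matrix.sum_apply]
  rw [this]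
  exact Matrix.posSemidef_sum _ fun i _ => (hA i).kronecker (hB i).transpose

end Separable

theorem sum_phase_mul {n : ℕ} (i k j l : Fin n) :
    ∑ f : Fin n → Fin 4, Complex.I ^ (f i : ℕ) * (-Complex.I) ^ (f k : ℕ) *
      ((-Complex.I) ^ (f j : ℕ) * Complex.I ^ (f l : ℕ)) =
    if (i = k ∧ j = l) ∨ (i = j ∧ k = l) then 4 ^ n else 0 := by
  have inv (a : ℕ) : Complex.I ^ a * (-Complex.I) ^ a = 1 := by
    rw [← mul_pow]; simp
  split_ifs with h
  · have (f : Fin n → Fin 4) : Complex.I ^ (f i : ℕ) * (-Complex.I) ^ (f k : ℕ) *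
        ((-Complex.I) ^ (f j : ℕ) * Complex.I ^ (f l : ℕ)) = 1 := by
      rcases h with ⟨rfl, rfl⟩ | ⟨rfl, rfl⟩
      · rw [inv, one_mul, mul_comm, inv]
      · linear_combination (Complex.I ^ (f k : ℕ) * (-Complex.I) ^ (f k : ℕ)) * inv (f i) + inv (f k)
    simp [this]
  · let g (m : Fin n) (a : Fin 4) : ℂ :=
      (if m = i then Complex.I ^ (a : ℕ) else 1) * (if m = k then (-Complex.I) ^ (a : ℕ) else 1) *
      ((if m = j then (-Complex.I) ^ (a : ℕ) else 1) * (if m = l then Complex.I ^ (a : ℕ) else 1))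
    have key : ∑ f : Fin n → Fin 4, ∏ m, g m (f m) = ∏ m, ∑ a, g m a := by
      rw [Finset.prod_univ_sum, Fintype.piFinset_univ]
    simp only [g, Finset.prod_mul_distrib, Finset.prod_ite_eq', Finset.mem_univ, if_true] at key
    rw [key]
    have I3 : Complex.I ^ 3 = -Complex.I := Complex.I_pow_three
    have I2 : Complex.I ^ 2 = -1 := Complex.I_sq
    by_cases hik : i = k
    · apply Finset.prod_eq_zero (Finset.mem_univ j)
      subst hik
      by_cases hij : j = i <;> have hjl : j ≠ l := by grind
      · simp [Fin.sum_univ_four, hij]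
        grind
      · simp [Fin.sum_univ_four, hij, hjl]
        grind
    · by_cases hij : i = j
      · have hkl : k ≠ l := by grind
        apply Finset.prod_eq_zero (Finset.mem_univ k)
        have hkj : k ≠ j := by grind
        simp [Fin.sum_univ_four, Ne.symm hik, hkj, hkl]
        grind
      · apply Finset.prod_eq_zero (Finset.mem_univ i)
        by_cases hil : i = l
        · simp [Fin.sum_univ_four, hik, hij, ← hil]
        · simp [Fin.sum_univ_four, hik, hij, hil]

/-- The average of the projections onto the product vectors `(z u) ⊗ (z̄ v)` over the diagonal
matrices `z` of fourth roots of unity. -/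
def phaseAverage {n : ℕ} (u v : Fin n → ℂ) : Matrix (Fin n × Fin n) (Fin n × Fin n) ℂ :=
  Matrix.of fun p q => if (p.1 = p.2 ∧ q.1 = q.2) ∨ p = q then
    u p.1 * v p.2 * star (u q.1 * v q.2) else 0

theorem separable_phaseAverage {n : ℕ} (u v : Fin n → ℂ) : Separable (phaseAverage u v) := by
  have h := (Separable.sum fun f : Fin n → Fin 4 => Separable.kronecker
    (Matrix.posSemidef_vecMulVec_self_star fun i => Complex.I ^ (f i : ℕ) * u i)
    (Matrix.posSemidef_vecMulVec_self_star fun i => (-Complex.I) ^ (f i : ℕ) * v i)).smul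
      (c := (4 ^ n)⁻¹) (by positivity)
  convert h using 1
  ext ⟨i, k⟩ ⟨j, l⟩
  have hsum : ∑ f : Fin n → Fin 4, (Complex.I ^ (f i : ℕ) * u i * star (Complex.I ^ (f j : ℕ) * u j))
      * ((-Complex.I) ^ (f k : ℕ) * v k * star ((-Complex.I) ^ (f l : ℕ) * v l)) =
      (if (i = k ∧ j = l) ∨ (i = j ∧ k = l) then 4 ^ n else 0) *
        (u i * v k * star (u j * v l)) := by
    rw [← sum_phase_mul, Finset.sum_mul]
    refine Finset.sum_congr rfl fun f _ => ?_
    simp only [star_mul', star_pow, star_neg, Complex.star_def, Complex.conj_I, neg_neg]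
    ring
  simp only [phaseAverage, Matrix.smul_apply, Matrix.sum_apply, Matrix.kroneckerMap_apply,
    Matrix.vecMulVec_apply, Pi.star_apply, Matrix.of_apply, Prod.mk.injEq]
  rw [hsum]
  split_ifs <;> simp

/-- The vector of `ℂⁿ ⊗ ℂⁿ` with Schmidt coefficients `s` in the standard bases. -/
def schmidtVec {n : ℕ} (s : Fin n → ℝ) : Fin n × Fin n → ℂ :=
  fun p => if p.1 = p.2 then (s p.1 : ℂ) else 0

theorem mul_le_half_of_sum_sq_eq_one {n : ℕ} {s : Fin n → ℝ} (hs : ∑ i, s i ^ 2 = 1)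
    {i j : Fin n} (hij : i ≠ j) : s i * s j ≤ 1 / 2 := by
  have : ∑ m ∈ {i, j}, s m ^ 2 ≤ 1 :=
    hs ▸ Finset.sum_le_sum_of_subset_of_nonneg (Finset.subset_univ _) fun _ _ _ => sq_nonneg _
  rw [Finset.sum_pair hij] at this
  nlinarith [sq_nonneg (s i - s j)]

theorem separable_one_add_schmidtVec {n : ℕ} {s : Fin n → ℝ} (h0 : ∀ i, 0 ≤ s i)
    (hs : ∑ i, s i ^ 2 = 1) {t : ℝ} (ht0 : 0 ≤ t) (ht : t ≤ 2) :
    Separable (1 + (t : ℂ) • Matrix.vecMulVec (schmidtVec s) (star (schmidtVec s))) := by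
  have hd (p : Fin n × Fin n) : 0 ≤ if p.1 = p.2 then 1 else 1 - t * (s p.1 * s p.2) := by
    split_ifs with h
    · exact zero_le_one
    · nlinarith [mul_le_half_of_sum_sq_eq_one hs h, mul_nonneg (h0 p.1) (h0 p.2)]
  have h := ((separable_phaseAverage (fun i => (√(s i) : ℂ)) fun i => (√(s i) : ℂ)).smul ht0).add
    (Separable.diagonal hd)
  convert h using 1
  have hsq (i : Fin n) : (√(s i) : ℂ) * √(s i) = s i := by
    rw [← Complex.ofReal_mul, Real.mul_self_sqrt (h0 i)]
  ext ⟨i, k⟩ ⟨j, l⟩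
  simp only [phaseAverage, schmidtVec, Matrix.add_apply, Matrix.smul_apply, Matrix.one_apply,
    Matrix.vecMulVec_apply, Pi.star_apply, Matrix.of_apply, Matrix.diagonal_apply, smul_eq_mul,
    Prod.mk.injEq, star_mul', Complex.star_def, apply_ite Complex.ofReal,
    apply_ite (starRingEnd ℂ), Complex.conj_ofReal, Complex.ofReal_one, Complex.ofReal_sub,
    Complex.ofReal_mul, map_zero]
  grind

theorem separable_one_sub_schmidtVec {n : ℕ} {s : Fin n → ℝ} (hs : ∑ i, s i ^ 2 = 1) :
    Separable (1 - Matrix.vecMulVec (schmidtVec s) (star (schmidtVec s))) := by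
  have hd (p : Fin n × Fin n) : 0 ≤ if p.1 = p.2 then 0 else 1 - s p.2 ^ 2 := by
    split_ifs with h
    · exact le_rfl
    · rw [sub_nonneg, ← hs]
      exact Finset.single_le_sum (f := fun i => s i ^ 2) (fun _ _ => sq_nonneg _)
        (Finset.mem_univ _)
  have h := ((Separable.sum fun i : Fin n => Separable.sum fun j : Fin n => separable_phaseAverage
    (fun m => (if i = m then (s j : ℂ) else 0) + if j = m then (s i : ℂ) else 0)
    (fun m => (if i = m then (1 : ℂ) else 0) - if j = m then (1 : ℂ) else 0)).smul
      (c := 1 / 2) (by norm_num)).add (Separable.diagonal hd)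
  convert h using 1
  have hs' : ∑ i, (s i : ℂ) ^ 2 = 1 := by exact_mod_cast hs
  ext ⟨i, k⟩ ⟨j, l⟩
  simp only [phaseAverage, schmidtVec, Matrix.add_apply, Matrix.smul_apply, Matrix.one_apply,
    Matrix.vecMulVec_apply, Pi.star_apply, Matrix.of_apply, Matrix.diagonal_apply, smul_eq_mul,
    Prod.mk.injEq, star_mul', star_add, star_sub, Complex.star_def, apply_ite Complex.ofReal,
    apply_ite (starRingEnd ℂ), Complex.conj_ofReal,
    map_zero, map_one, Matrix.sum_apply, Matrix.sub_apply]
  by_cases hd : i = k ∧ j = l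
  · obtain ⟨rfl, rfl⟩ := hd
    simp only [and_self, true_or, if_true]
    trans (1 / 2 : ℂ) * ∑ a, ∑ b, ((if i = a then if j = a then (s b : ℂ) ^ 2 else 0 else 0) +
      (if i = b then if j = b then (s a : ℂ) ^ 2 else 0 else 0) -
      (if i = a then if j = b then (s i * s j : ℂ) else 0 else 0) -
      (if j = a then if i = b then (s i * s j : ℂ) else 0 else 0))
    · simp only [Finset.sum_add_distrib, Finset.sum_sub_distrib, Finset.sum_ite_eq,
        Finset.mem_univ, if_true, Finset.sum_ite_irrel, Finset.sum_const_zero, hs']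
      grind
    · rw [Complex.ofReal_zero, ite_self, add_zero]
      push_cast
      congr 1
      refine Finset.sum_congr rfl fun a _ => Finset.sum_congr rfl fun b _ => ?_
      grind
  · by_cases he : i = j ∧ k = l
    · obtain ⟨rfl, rfl⟩ := he
      have hik : i ≠ k := by grind
      simp only [hik, and_self, or_true, if_true, if_false]
      trans (1 / 2 : ℂ) * ∑ a, ∑ b, ((if i = a then if k = b then (s k : ℂ) ^ 2 else 0 else 0) +
        (if k = a then if i = b then (s k : ℂ) ^ 2 else 0 else 0)) + (1 - s k ^ 2)
      · simp only [Finset.sum_add_distrib, Finset.sum_ite_eq,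
          Finset.mem_univ, if_true, Finset.sum_ite_irrel, Finset.sum_const_zero]
        ring
      · push_cast
        congr 2
        refine Finset.sum_congr rfl fun a _ => Finset.sum_congr rfl fun b _ => ?_
        grind
    · simp only [hd, he, or_self, if_false, Finset.sum_const_zero]
      grind

theorem separable_one_add_smul_schmidtVec {n : ℕ} {s : Fin n → ℝ} (h0 : ∀ i, 0 ≤ s i)
    (hs : ∑ i, s i ^ 2 = 1) {t : ℝ} (ht0 : -1 ≤ t) (ht : t ≤ 2) :
    Separable (1 + (t : ℂ) • Matrix.vecMulVec (schmidtVec s) (star (schmidtVec s))) := by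
  rcases le_total 0 t with h | h
  · exact separable_one_add_schmidtVec h0 hs h ht
  · have h1 : Separable (1 : Matrix (Fin n × Fin n) (Fin n × Fin n) ℂ) := by
      simpa using Separable.diagonal (d := fun _ : Fin n × Fin n => 1) fun _ => zero_le_one
    convert (h1.smul (c := 1 + t) (by linarith)).add
      ((separable_one_sub_schmidtVec hs).smul (c := -t) (by linarith)) using 1
    push_cast
    module

section Unitary

variable {𝕜 ι : Type*} [RCLike 𝕜] [Fintype ι] [DecidableEq ι]

theorem exists_unitary_col_eq {v : ι → EuclideanSpace 𝕜 ι} {S : Set ι}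
    (hv : Orthonormal 𝕜 (S.domRestrict v)) :
    ∃ U ∈ Matrix.unitaryGroup ι 𝕜, ∀ i ∈ S, ∀ a, U a i = v i a := by
  obtain ⟨b, hb⟩ := hv.exists_orthonormalBasis_extension_of_card_eq finrank_euclideanSpace
  exact ⟨_, (EuclideanSpace.basisFun ι 𝕜).toMatrix_orthonormalBasis_mem_unitary b,
    fun i hi a => by simp [Module.Basis.toMatrix_apply, hb i hi]⟩

theorem exists_unitary_mulVec_single_eq {x : ι → 𝕜} (hx : star x ⬝ᵥ x = 1) (i : ι) :
    ∃ U ∈ Matrix.unitaryGroup ι 𝕜, U *ᵥ Pi.single i 1 = x := by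
  obtain ⟨U, hU, h⟩ := exists_unitary_col_eq (S := {i})
    (v := fun _ => (WithLp.toLp 2 x : EuclideanSpace 𝕜 ι)) (by
      rw [orthonormal_iff_ite]
      rintro ⟨a, rfl⟩ ⟨b, rfl⟩
      rw [if_pos rfl, ← hx, dotProduct_comm]
      exact EuclideanSpace.inner_eq_star_dotProduct _ _)
  exact ⟨U, hU, by ext a; simp [h]⟩

theorem exists_unitary_mulVec_eq [Nonempty ι] {x y : ι → 𝕜} (hx : star x ⬝ᵥ x = 1)
    (hy : star y ⬝ᵥ y = 1) : ∃ U ∈ Matrix.unitaryGroup ι 𝕜, U *ᵥ x = y := by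
  obtain ⟨U, hU, rfl⟩ := exists_unitary_mulVec_single_eq hx (Classical.arbitrary ι)
  obtain ⟨V, hV, rfl⟩ := exists_unitary_mulVec_single_eq hy (Classical.arbitrary ι)
  refine ⟨V * star U, mul_mem hV (Unitary.star_mem hU), ?_⟩
  rw [Matrix.mulVec_mulVec, mul_assoc, Matrix.mem_unitaryGroup_iff'.1 hU, mul_one]

/-- Singular value decomposition of a square matrix. -/
theorem exists_singularValueDecomposition (M : Matrix ι ι 𝕜) :
    ∃ U ∈ Matrix.unitaryGroup ι 𝕜, ∃ V ∈ Matrix.unitaryGroup ι 𝕜, ∃ s : ι → ℝ,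
      (∀ i, 0 ≤ s i) ∧ M = U * Matrix.diagonal (fun i => (s i : 𝕜)) * V := by
  have hM := Matrix.posSemidef_conjTranspose_mul_self M
  set W : Matrix ι ι 𝕜 := (hM.isHermitian.eigenvectorUnitary : Matrix ι ι 𝕜)
  have hWmem : W ∈ Matrix.unitaryGroup ι 𝕜 := hM.isHermitian.eigenvectorUnitary.2
  set s : ι → ℝ := fun i => √(hM.isHermitian.eigenvalues i)
  have hN : (M * W)ᴴ * (M * W) = Matrix.diagonal fun i => (s i : 𝕜) ^ 2 := by
    have h := hM.isHermitian.conjStarAlgAut_star_eigenvectorUnitary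
    rw [Unitary.conjStarAlgAut_star_apply] at h
    rw [Matrix.conjTranspose_mul, mul_assoc, ← mul_assoc Mᴴ, ← mul_assoc]
    refine h.trans (congrArg Matrix.diagonal (funext fun i => ?_))
    rw [← RCLike.ofReal_pow, Real.sq_sqrt (hM.eigenvalues_nonneg i), Function.comp_apply]
  have hinner (i j : ι) :
      ∑ a, star ((M * W) a i) * (M * W) a j = if i = j then (s i : 𝕜) ^ 2 else 0 := by
    have := congrFun (congrFun hN i) j
    rwa [Matrix.mul_apply, Matrix.diagonal_apply] at this
  obtain ⟨U, hU, hUs⟩ := exists_unitary_col_eq (S := {i | s i ≠ 0})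
    (v := fun i => (WithLp.toLp 2 fun a => (s i : 𝕜)⁻¹ * (M * W) a i : EuclideanSpace 𝕜 ι)) (by
      rw [orthonormal_iff_ite]
      rintro ⟨i, hi⟩ ⟨j, hj⟩
      have hi' : (s i : 𝕜) ≠ 0 := by exact_mod_cast hi
      have key : ∑ a, (s j : 𝕜)⁻¹ * (M * W) a j * star ((s i : 𝕜)⁻¹ * (M * W) a i) =
          (s i : 𝕜)⁻¹ * (s j : 𝕜)⁻¹ * ∑ a, star ((M * W) a i) * (M * W) a j := by
        rw [Finset.mul_sum]
        refine Finset.sum_congr rfl fun a _ => ?_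
        simp only [star_mul', star_inv₀, RCLike.star_def, RCLike.conj_ofReal]
        ring
      rw [hinner] at key
      simp only [Set.domRestrict_apply, EuclideanSpace.inner_eq_star_dotProduct, dotProduct,
        Pi.star_apply, Subtype.mk.injEq]
      rw [key]
      split_ifs with h
      · subst h
        field_simp
      · simp)
  refine ⟨U, hU, star W, Unitary.star_mem hWmem, s, fun i => Real.sqrt_nonneg _, ?_⟩
  have hUD : U * Matrix.diagonal (fun i => (s i : 𝕜)) = M * W := by
    ext a i
    rw [Matrix.mul_diagonal]
    by_cases hi : s i = 0
    · have h := hinner i i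
      simp only [hi, if_true, RCLike.ofReal_zero, ne_eq, OfNat.ofNat_ne_zero, not_false_eq_true,
        zero_pow, RCLike.star_def, RCLike.conj_mul] at h
      norm_cast at h
      rw [Finset.sum_eq_zero_iff_of_nonneg fun _ _ => sq_nonneg _] at h
      have := h a (Finset.mem_univ a)
      simp_all
    · have hi' : (s i : 𝕜) ≠ 0 := by exact_mod_cast hi
      rw [hUs i hi]
      field_simp
  rw [hUD, mul_assoc, Matrix.mem_unitaryGroup_iff.1 hWmem, mul_one]

theorem star_mulVec_dotProduct_mulVec {U : Matrix ι ι 𝕜} (hU : U ∈ Matrix.unitaryGroup ι 𝕜)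
    (x : ι → 𝕜) : star (U *ᵥ x) ⬝ᵥ (U *ᵥ x) = star x ⬝ᵥ x := by
  rw [Matrix.star_mulVec, ← Matrix.dotProduct_mulVec, Matrix.mulVec_mulVec,
    ← Matrix.star_eq_conjTranspose, Matrix.mem_unitaryGroup_iff'.1 hU, Matrix.one_mulVec]

theorem conj_smul_one_add_smul_vecMulVec {U : Matrix ι ι 𝕜} (hU : U ∈ Matrix.unitaryGroup ι 𝕜)
    (c d : 𝕜) (x : ι → 𝕜) :
    U * (c • (1 : Matrix ι ι 𝕜) + d • Matrix.vecMulVec x (star x)) * Uᴴ =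
      c • (1 : Matrix ι ι 𝕜) + d • Matrix.vecMulVec (U *ᵥ x) (star (U *ᵥ x)) := by
  have hU' : U * Uᴴ = 1 := Matrix.mem_unitaryGroup_iff.1 hU
  rw [mul_add, add_mul, Matrix.mul_smul, Matrix.smul_mul, mul_one, hU', Matrix.mul_smul,
    Matrix.smul_mul, Matrix.mul_vecMulVec, Matrix.vecMulVec_mul, Matrix.star_mulVec]

end Unitary

/-- Schmidt decomposition of a bipartite vector. -/
theorem exists_schmidt_decomposition {n : ℕ} (x : Fin n × Fin n → ℂ) :
    ∃ P ∈ Matrix.unitaryGroup (Fin n) ℂ, ∃ Q ∈ Matrix.unitaryGroup (Fin n) ℂ, ∃ s : Fin n → ℝ,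
      (∀ i, 0 ≤ s i) ∧ x = Matrix.kroneckerMap (· * ·) P Q *ᵥ schmidtVec s := by
  obtain ⟨U, hU, V, hV, s, h0, h⟩ :=
    exists_singularValueDecomposition (Matrix.of fun i k => x (i, k))
  refine ⟨U, hU, Vᵀ, Matrix.transpose_mem_unitaryGroup_iff.2 hV, s, h0, ?_⟩
  ext ⟨i, k⟩
  have := congrFun (congrFun h i) k
  rw [Matrix.mul_apply] at this
  simp only [Matrix.of_apply, Matrix.mul_diagonal] at this
  rw [this]
  simp only [Matrix.mulVec, dotProduct, schmidtVec, Matrix.kroneckerMap_apply,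
    Matrix.transpose_apply, Fintype.sum_prod_type, mul_ite, mul_zero, Finset.sum_ite_eq,
    Finset.mem_univ, if_true]
  exact Finset.sum_congr rfl fun a _ => mul_right_comm _ _ _

theorem star_schmidtVec_dotProduct {n : ℕ} (s : Fin n → ℝ) :
    star (schmidtVec s) ⬝ᵥ schmidtVec s = ((∑ i, s i ^ 2 : ℝ) : ℂ) := by
  simp [dotProduct, schmidtVec, Fintype.sum_prod_type, apply_ite (starRingEnd ℂ), sq]

theorem separable_one_add_smul_vecMulVec {n : ℕ} {x : Fin n × Fin n → ℂ}
    (hx : star x ⬝ᵥ x = 1) {t : ℝ} (ht0 : -1 ≤ t) (ht : t ≤ 2) :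
    Separable (1 + (t : ℂ) • Matrix.vecMulVec x (star x)) := by
  obtain ⟨P, hP, Q, hQ, s, h0, rfl⟩ := exists_schmidt_decomposition x
  have hPQ : Matrix.kroneckerMap (· * ·) P Q ∈ Matrix.unitaryGroup (Fin n × Fin n) ℂ :=
    Matrix.kronecker_mem_unitary hP hQ
  rw [star_mulVec_dotProduct_mulVec hPQ, star_schmidtVec_dotProduct] at hx
  have h := (separable_one_add_smul_schmidtVec h0 (by exact_mod_cast hx) ht0 ht).conj_kronecker P Q
  rw [← one_smul ℂ (1 : Matrix (Fin n × Fin n) (Fin n × Fin n) ℂ),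
    conj_smul_one_add_smul_vecMulVec hPQ] at h
  rwa [one_smul] at h

theorem psiPlus_eq_schmidtVec (n : ℕ) : psiPlus n = schmidtVec fun _ => 1 / √(n : ℝ) := rfl

theorem star_psiPlus_dotProduct {n : ℕ} (hn : n ≠ 0) : star (psiPlus n) ⬝ᵥ psiPlus n = 1 := by
  have : (n : ℝ) ≠ 0 := Nat.cast_ne_zero.2 hn
  rw [psiPlus_eq_schmidtVec, star_schmidtVec_dotProduct]
  simp [this]

theorem AbsolutelySeparable.absolutelyPPT {m n : ℕ}
    {ρ : Matrix (Fin m × Fin n) (Fin m × Fin n) ℂ} (h : AbsolutelySeparable ρ) :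
    AbsolutelyPPT ρ :=
  fun U hU => (h U hU).posSemidef_partialTranspose

/-- Two equal nonzero Schmidt coefficients give the strongest violation of the PPT condition. -/
theorem le_two_mul_of_absolutelyPPT {n : ℕ} (hn : 2 ≤ n) {c d : ℝ} {x : Fin n × Fin n → ℂ}
    (hx : star x ⬝ᵥ x = 1)
    (h : AbsolutelyPPT ((c : ℂ) • (1 : Matrix (Fin n × Fin n) (Fin n × Fin n) ℂ) +
      (d : ℂ) • Matrix.vecMulVec x (star x))) : d ≤ 2 * c := by
  obtain ⟨n, rfl⟩ := Nat.exists_eq_add_of_le' hn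
  let s : Fin (n + 2) → ℝ := fun i => if (i : ℕ) < 2 then √(1 / 2) else 0
  have hs : ∑ i, s i ^ 2 = 1 := by
    have (i : Fin n) : s i.succ.succ = 0 := by simp [s]
    simp only [Fin.sum_univ_succ, this]
    norm_num [s]
  obtain ⟨U, hU, hUx⟩ := exists_unitary_mulVec_eq hx
    (show star (schmidtVec s) ⬝ᵥ schmidtVec s = 1 by rw [star_schmidtVec_dotProduct, hs]; simp)
  have hpsd := h U hU
  rw [conj_smul_one_add_smul_vecMulVec hU, hUx] at hpsd
  have h2 := (hpsd.submatrix
    ![((0 : Fin (n + 2)), (1 : Fin (n + 2))), (1, 0)]).dotProduct_mulVec_nonneg ![1, -1]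
  have hsqrt : (√2)⁻¹ * (√2)⁻¹ = (1 / 2 : ℝ) := by
    rw [← mul_inv, Real.mul_self_sqrt zero_le_two, one_div]
  simp [partialTranspose, schmidtVec, s, Matrix.mulVec, dotProduct, Fin.sum_univ_two,
    Matrix.vecMulVec_apply, Matrix.one_apply] at h2
  norm_cast at h2
  rw [hsqrt] at h2
  linarith

theorem absolutelySeparable_smul_one_add {n : ℕ} {c d : ℝ} (hc : 0 < c) (hd : -c ≤ d)
    (hd' : d ≤ 2 * c) {x : Fin n × Fin n → ℂ} (hx : star x ⬝ᵥ x = 1) :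
    AbsolutelySeparable ((c : ℂ) • (1 : Matrix (Fin n × Fin n) (Fin n × Fin n) ℂ) +
      (d : ℂ) • Matrix.vecMulVec x (star x)) := by
  intro U hU
  rw [conj_smul_one_add_smul_vecMulVec hU]
  have h := (separable_one_add_smul_vecMulVec (t := d / c)
    ((star_mulVec_dotProduct_mulVec hU x).trans hx) (by rw [le_div_iff₀ hc]; linarith)
    (by rwa [div_le_iff₀ hc])).smul hc.le
  rwa [smul_add, smul_smul, ← Complex.ofReal_mul, mul_div_cancel₀ _ hc.ne'] at h

/-- For isotropic states, absolute separability, absolute PPT, and `α ≤ 2/(2+n²)` are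
all equivalent. -/
theorem isotropic_absSep_iff_absPPT_iff {n : ℕ} (hn : 2 ≤ n) (α : ℝ)
    (hα₁ : -(1 / ((n : ℝ) ^ 2 - 1)) ≤ α) (hα₂ : α ≤ 1)
    (ρ : Matrix (Fin n × Fin n) (Fin n × Fin n) ℂ)
    (hρdef : ρ = (((1 - α) / (n : ℝ) ^ 2 : ℝ) : ℂ) • (1 : Matrix (Fin n × Fin n) (Fin n × Fin n) ℂ)
        + ((α : ℝ) : ℂ) • Matrix.vecMulVec (psiPlus n) (star (psiPlus n))) :
    (AbsolutelySeparable ρ ↔ AbsolutelyPPT ρ) ∧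
    (AbsolutelyPPT ρ ↔ α ≤ 2 / (2 + (n : ℝ) ^ 2)) := by
  subst hρdef
  have hn' : (2 : ℝ) ≤ n := by exact_mod_cast hn
  have hn2 : (4 : ℝ) ≤ (n : ℝ) ^ 2 := by nlinarith
  have hψ := star_psiPlus_dotProduct (n := n) (by omega)
  have hiff : α ≤ 2 / (2 + (n : ℝ) ^ 2) ↔ α ≤ 2 * ((1 - α) / (n : ℝ) ^ 2) := by
    rw [le_div_iff₀ (by positivity), mul_div_assoc', le_div_iff₀ (by positivity)]
    constructor <;> intro h <;> linarith
  have hsep (h : α ≤ 2 / (2 + (n : ℝ) ^ 2)) := absolutelySeparable_smul_one_add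
    (c := (1 - α) / (n : ℝ) ^ 2) (d := α)
    (div_pos (by
      have : 2 / (2 + (n : ℝ) ^ 2) < 1 := by rw [div_lt_one (by positivity)]; linarith
      linarith) (by positivity))
    (by
      rw [← neg_div, div_le_iff₀ (by linarith)] at hα₁
      rw [← neg_div, div_le_iff₀ (by positivity)]
      linarith)
    (hiff.1 h) hψ
  have hppt := fun h => hiff.2 (le_two_mul_of_absolutelyPPT (d := α) hn hψ h)
  exact ⟨⟨AbsolutelySeparable.absolutelyPPT, fun h => hsep (hppt h)⟩,
    hppt, fun h => (hsep h).absolutelyPPT⟩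

end
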